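/- arXiv:2402.13816 — 2 statements merged into one kernel-verified Lean document; each statement's English description precedes it below -/
import Mathlib

section
/- Let X ∈ ℝ^{n×k}, let D ∈ ℝ^{k×k} be a diagonal matrix such that Q = XᵀX + D is positive definite, and let 𝟙_k ∈ ℝ^k be the all-ones vector. Set Θ* = I_k − ( Q⁻¹ − (Q⁻¹𝟙_k)(Q⁻¹𝟙_k)ᵀ / (𝟙_kᵀ Q⁻¹ 𝟙_k) ) D. Then Θ* satisfies (Θ*)ᵀ𝟙_k = 𝟙_k and Θ* minimizes the function Θ ↦ ‖XΘ − X‖_F² + tr(Θᵀ D Θ) over the set {Θ ∈ ℝ^{k×k} : Θᵀ𝟙_k = 𝟙_k}. -/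
open Matrix

/-- Squared Frobenius norm of a real matrix. -/
noncomputable def frobSq {n k : ℕ} (M : Matrix (Fin n) (Fin k) ℝ) : ℝ :=
  ∑ i, ∑ j, (M i j) ^ 2

/-- The all-ones vector `𝟙_k`. -/
def onesVec (k : ℕ) : Fin k → ℝ := fun _ => 1

theorem frobSq_eq_trace {n k : ℕ} (M : Matrix (Fin n) (Fin k) ℝ) :
    frobSq M = Matrix.trace (Mᵀ * M) := by
  simp only [frobSq, Matrix.trace, Matrix.diag, Matrix.mul_apply, Matrix.transpose_apply, ← sq]
  exact Finset.sum_comm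

/-- The objective, expanded to second order around `Θ`. -/
theorem objective_add {n k : ℕ} (X : Matrix (Fin n) (Fin k) ℝ) {D : Matrix (Fin k) (Fin k) ℝ}
    (hD : Dᵀ = D) (Θ H : Matrix (Fin k) (Fin k) ℝ) :
    frobSq (X * (Θ + H) - X) + Matrix.trace ((Θ + H)ᵀ * D * (Θ + H)) =
      frobSq (X * Θ - X) + Matrix.trace (Θᵀ * D * Θ) +
        2 * Matrix.trace (Hᵀ * ((Xᵀ * X + D) * (Θ - 1) + D)) +
        Matrix.trace (Hᵀ * (Xᵀ * X + D) * H) := by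
  have h1 : Matrix.trace (Θᵀ * D * H) = Matrix.trace (Hᵀ * D * Θ) := by
    rw [← Matrix.trace_transpose]
    simp only [Matrix.transpose_mul, Matrix.transpose_transpose, hD, Matrix.mul_assoc]
  have h2 : Matrix.trace ((X * Θ - X)ᵀ * (X * H)) = Matrix.trace ((X * H)ᵀ * (X * Θ - X)) := by
    rw [← Matrix.trace_transpose, Matrix.transpose_mul, Matrix.transpose_transpose]
  have h3 : X * (Θ + H) - X = (X * Θ - X) + X * H := by
    rw [Matrix.mul_add]; abel
  have h4 : Hᵀ * ((Xᵀ * X + D) * (Θ - 1) + D) = (X * H)ᵀ * (X * Θ - X) + Hᵀ * D * Θ := by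
    simp only [Matrix.transpose_mul, Matrix.mul_add, Matrix.add_mul, Matrix.mul_sub,
      Matrix.mul_one, Matrix.mul_assoc]
    abel
  have h5 : Hᵀ * (Xᵀ * X + D) * H = (X * H)ᵀ * (X * H) + Hᵀ * D * H := by
    simp only [Matrix.transpose_mul, Matrix.mul_add, Matrix.add_mul, Matrix.mul_assoc]
  rw [frobSq_eq_trace, frobSq_eq_trace, h3, h4, h5]
  generalize X * Θ - X = A at *
  generalize X * H = B at *
  simp only [Matrix.transpose_add, Matrix.mul_add, Matrix.add_mul, Matrix.trace_add, h1, h2]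
  ring

theorem stmt5 (n k : ℕ) (X : Matrix (Fin n) (Fin k) ℝ) (D : Matrix (Fin k) (Fin k) ℝ)
    (hD : D.IsDiag) (hQ : (Xᵀ * X + D).PosDef) :
    let Q := Xᵀ * X + D
    let u : Fin k → ℝ := Q⁻¹.mulVec (onesVec k)
    let Θs : Matrix (Fin k) (Fin k) ℝ :=
      1 - (Q⁻¹ - (onesVec k ⬝ᵥ u)⁻¹ • vecMulVec u u) * D
    Θsᵀ.mulVec (onesVec k) = onesVec k ∧
    ∀ Θ : Matrix (Fin k) (Fin k) ℝ,
      Θᵀ.mulVec (onesVec k) = onesVec k →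
      frobSq (X * Θs - X) + Matrix.trace (Θsᵀ * D * Θs) ≤
        frobSq (X * Θ - X) + Matrix.trace (Θᵀ * D * Θ) := by
  intro Q u Θs
  have hDt : Dᵀ = D := hD.isSymm
  have hQQ : Q * Q⁻¹ = 1 := Matrix.mul_nonsing_inv Q ((Matrix.isUnit_iff_isUnit_det _).1 hQ.isUnit)
  have hQit : (Q⁻¹)ᵀ = Q⁻¹ := by
    have := hQ.inv.isHermitian.eq
    rwa [Matrix.conjTranspose_eq_transpose_of_trivial] at this
  have hQu : Q *ᵥ u = onesVec k := by
    simp only [u, Matrix.mulVec_mulVec, hQQ, Matrix.one_mulVec]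
  have hPe : (onesVec k ⬝ᵥ u)⁻¹ • (onesVec k ⬝ᵥ u) • u = u := by
    by_cases he : onesVec k = 0
    · simp [u, he]
    · have : 0 < onesVec k ⬝ᵥ u := by
        simpa using hQ.inv.dotProduct_mulVec_pos he
      rw [smul_smul, inv_mul_cancel₀ this.ne', one_smul]
  have hfeas : Θsᵀ *ᵥ onesVec k = onesVec k := by
    have : (Q⁻¹ - (onesVec k ⬝ᵥ u)⁻¹ • vecMulVec u u)ᵀ *ᵥ onesVec k = 0 := by
      rw [Matrix.transpose_sub, Matrix.transpose_smul, Matrix.transpose_vecMulVec, hQit,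
        Matrix.sub_mulVec, Matrix.smul_mulVec, Matrix.vecMulVec_mulVec, op_smul_eq_smul,
        dotProduct_comm u, hPe, sub_self]
    simp only [Θs, Matrix.transpose_sub _ (_ * D), Matrix.transpose_mul, Matrix.transpose_one,
      Matrix.sub_mulVec 1, Matrix.one_mulVec, ← Matrix.mulVec_mulVec, this, Matrix.mulVec_zero,
      sub_zero]
  refine ⟨hfeas, fun Θ hΘ => ?_⟩
  obtain ⟨H, rfl⟩ : ∃ H, Θ = Θs + H := ⟨Θ - Θs, by abel⟩
  have hH : Hᵀ *ᵥ onesVec k = 0 := by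
    rw [Matrix.transpose_add, Matrix.add_mulVec, hfeas] at hΘ
    simpa using hΘ
  have hgrad : Q * (Θs - 1) + D =
      (onesVec k ⬝ᵥ u)⁻¹ • (vecMulVec (onesVec k) u * D) := by
    have : Θs - 1 = -((Q⁻¹ - (onesVec k ⬝ᵥ u)⁻¹ • vecMulVec u u) * D) := by
      simp only [Θs]; abel
    rw [this, Matrix.mul_neg, ← Matrix.mul_assoc, Matrix.mul_sub, hQQ, Matrix.mul_smul,
      Matrix.mul_vecMulVec, hQu, Matrix.sub_mul, Matrix.one_mul, Matrix.smul_mul]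
    abel
  have hfirst : Matrix.trace (Hᵀ * (Q * (Θs - 1) + D)) = 0 := by
    rw [hgrad, Matrix.mul_smul, ← Matrix.mul_assoc, Matrix.mul_vecMulVec, hH]
    simp
  have hsecond : 0 ≤ Matrix.trace (Hᵀ * Q * H) := by
    have := (hQ.posSemidef.conjTranspose_mul_mul_same H).trace_nonneg
    rwa [Matrix.conjTranspose_eq_transpose_of_trivial] at this
  have := objective_add X hDt Θs H
  linarith
end

section
/- Let Y ∈ ℝ^{n×k} be a fixed matrix, σ > 0, and define μ_Y = (1/k)·Y𝟙_k ∈ ℝ^n and C_Y = (1/k)·(Y − μ_Y𝟙_kᵀ)(Y − μ_Y𝟙_kᵀ)ᵀ ∈ ℝ^{n×n}. Assume C_Y is positive definite. Then the function (Θ, β) ↦ ‖ΘY − Y + β𝟙_kᵀ‖_F² + 2·k·σ²·tr(Θ) on ℝ^{n×n} × ℝ^n attains its global minimum at Θ̂ = (C_Y − σ²I_n)C_Y⁻¹ and β̂ = (I_n − Θ̂)μ_Y; that is, for every Θ ∈ ℝ^{n×n} and β ∈ ℝ^n, the objective at (Θ̂, β̂) is less than or equal to the objective at (Θ, β). -/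
open Matrix

theorem frobSq_nonneg {n k : ℕ} (M : Matrix (Fin n) (Fin k) ℝ) : 0 ≤ frobSq M :=
  Finset.sum_nonneg fun _ _ => Finset.sum_nonneg fun _ _ => sq_nonneg _

theorem frobSq_add {n k : ℕ} (A D : Matrix (Fin n) (Fin k) ℝ) :
    frobSq (A + D) = frobSq A + 2 * trace (A * Dᵀ) + frobSq D := by
  simp only [frobSq, trace, diag_apply, mul_apply, transpose_apply, Matrix.add_apply, Finset.mul_sum,
    ← Finset.sum_add_distrib]
  refine Finset.sum_congr rfl fun i _ => Finset.sum_congr rfl fun j _ => ?_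
  ring

/-- Centering the columns of a matrix at their empirical mean makes them sum to zero. -/
theorem centered_mulVec_onesVec {n k : ℕ} (hk : (k : ℝ) ≠ 0) (Y : Matrix (Fin n) (Fin k) ℝ) :
    (Y - vecMulVec ((k : ℝ)⁻¹ • Y.mulVec (onesVec k)) (onesVec k)).mulVec (onesVec k) = 0 := by
  have hones : onesVec k ⬝ᵥ onesVec k = (k : ℝ) := by simp [onesVec, dotProduct]
  rw [sub_mulVec, vecMulVec_mulVec, hones]
  ext i
  simp only [Pi.sub_apply, Pi.smul_apply, MulOpposite.smul_eq_mul_unop, MulOpposite.unop_op,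
    smul_eq_mul, Pi.zero_apply]
  field_simp
  ring

theorem stmt14 (n k : ℕ) (Y : Matrix (Fin n) (Fin k) ℝ) (σ : ℝ) (hσ : 0 < σ) :
    let μY : Fin n → ℝ := (k : ℝ)⁻¹ • Y.mulVec (onesVec k)
    let CY : Matrix (Fin n) (Fin n) ℝ :=
      (k : ℝ)⁻¹ • ((Y - vecMulVec μY (onesVec k)) * (Y - vecMulVec μY (onesVec k))ᵀ)
    CY.PosDef →
    let Θh : Matrix (Fin n) (Fin n) ℝ := (CY - σ ^ 2 • (1 : Matrix (Fin n) (Fin n) ℝ)) * CY⁻¹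
    let βh : Fin n → ℝ := ((1 : Matrix (Fin n) (Fin n) ℝ) - Θh).mulVec μY
    ∀ (Θ : Matrix (Fin n) (Fin n) ℝ) (β : Fin n → ℝ),
      frobSq (Θh * Y - Y + vecMulVec βh (onesVec k)) + 2 * k * σ ^ 2 * Matrix.trace Θh ≤
        frobSq (Θ * Y - Y + vecMulVec β (onesVec k)) + 2 * k * σ ^ 2 * Matrix.trace Θ := by
  intro μ C hC Θh βh Θ β
  rcases Nat.eq_zero_or_pos k with rfl | hkpos
  · simp [frobSq]
  have hk : (k : ℝ) ≠ 0 := Nat.cast_ne_zero.mpr hkpos.ne'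
  set Z := Y - vecMulVec μ (onesVec k) with hZ
  have hZ1 : Z.mulVec (onesVec k) = 0 := centered_mulVec_onesVec hk Y
  have hZZ : Z * Zᵀ = (k : ℝ) • C := by
    simp only [C, hZ, smul_smul, mul_inv_cancel₀ hk, one_smul]
  have hdet : IsUnit C.det := (isUnit_iff_isUnit_det C).mp hC.isUnit
  have hΘC : (Θh - 1) * C = -(σ ^ 2 • (1 : Matrix (Fin n) (Fin n) ℝ)) := by
    simp only [Θh]
    rw [Matrix.sub_mul, nonsing_inv_mul_cancel_right _ _ hdet, Matrix.one_mul]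
    abel
  have hres : Θh * Y - Y + vecMulVec βh (onesVec k) = (Θh - 1) * Z := by
    simp only [hZ, βh, Matrix.mul_sub, mul_vecMulVec, Matrix.sub_mul, Matrix.one_mul, sub_mulVec, one_mulVec,
      sub_vecMulVec]
    abel
  set Δ := Θ - Θh with hΔ
  set δ := Δ.mulVec μ + (β - βh) with hδ
  have hsplit : Θ * Y - Y + vecMulVec β (onesVec k) =
      (Θh - 1) * Z + (Δ * Z + vecMulVec δ (onesVec k)) := by
    rw [← hres]
    simp only [hZ, hδ, hΔ, Matrix.mul_sub, mul_vecMulVec, Matrix.sub_mul, sub_mulVec, sub_vecMulVec,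
      add_vecMulVec]
    abel
  have hcross : (Θh - 1) * Z * (Δ * Z + vecMulVec δ (onesVec k))ᵀ =
      -((k * σ ^ 2) • Δᵀ) := by
    rw [transpose_add, transpose_mul, transpose_vecMulVec, Matrix.mul_add,
      Matrix.mul_assoc _ Z (vecMulVec _ _),
      mul_vecMulVec, hZ1, zero_vecMulVec, Matrix.mul_zero, add_zero, Matrix.mul_assoc,
      ← Matrix.mul_assoc Z, hZZ, ← Matrix.mul_assoc, Matrix.mul_smul, hΘC]
    simp [smul_smul]
  rw [hsplit, hres, frobSq_add, hcross, trace_neg, trace_smul, trace_transpose, hΔ, trace_sub,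
    smul_eq_mul]
  linarith [frobSq_nonneg (Δ * Z + vecMulVec δ (onesVec k))]
end
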